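/- Let s ≥ 1 be an integer and C a finite set with |C| ≥ 2. There exists a finite family F of functions from C to [s], with |F| ≤ 4·|C|², such that for every finite collection L₁, …, L_t of subsets of C: (1/|F|) · Σ_{r ∈ F} Σ_{i ∈ [t]} max_{j ∈ [s]} (|L_i ∩ r^{−1}(j)| − 1) ≤ (1/√s) · Σ_{i ∈ [t]} (|L_i| − 1). In particular, there exists r ∈ F for which Σ_{i ∈ [t]} max_{j ∈ [s]} (|L_i ∩ r^{−1}(j)| − 1) ≤ (1/√s) · Σ_{i ∈ [t]} (|L_i| − 1). -/

import Mathlib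

open Finset

/-- Among the subsets of prescribed size of a family of vectors with zero sum, some one has a sum
that is no longer than a sum of that many orthogonal vectors of average squared length. -/
theorem exists_card_eq_norm_sum_sq_le {α E : Type*} [Fintype α] [DecidableEq α]
    [NormedAddCommGroup E] [InnerProductSpace ℝ E] (v : α → E) (hv : ∑ a, v a = 0) (N : ℕ)
    (hN : N ≤ Fintype.card α) :
    ∃ F : Finset α, F.card = N ∧
      (Fintype.card α : ℝ) * ‖∑ a ∈ F, v a‖ ^ 2 ≤ N * ∑ a, ‖v a‖ ^ 2 := by
  induction N with
  | zero => exact ⟨∅, by simp⟩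
  | succ N ih =>
    obtain ⟨F, hF, hle⟩ := ih (by omega)
    have hD : 0 ≤ ∑ a, ‖v a‖ ^ 2 := by positivity
    rcases hN.eq_or_lt with h1 | h1
    · refine ⟨univ, by simpa using h1.symm, ?_⟩
      rw [hv]
      simp only [norm_zero]
      norm_num
      positivity
    have hcard : (Fᶜ.card : ℝ) = Fintype.card α - N := by
      rw [card_compl, Nat.cast_sub (by omega), hF]
    have hcompl : ∑ a ∈ Fᶜ, v a = -∑ a ∈ F, v a := by
      rw [eq_neg_iff_add_eq_zero, sum_compl_add_sum, hv]
    have hsq : ∑ a ∈ Fᶜ, ‖v a‖ ^ 2 ≤ ∑ a, ‖v a‖ ^ 2 :=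
      sum_le_sum_of_subset_of_nonneg (subset_univ _) fun _ _ _ => by positivity
    have hsum : ∑ a ∈ Fᶜ, ‖∑ b ∈ F, v b + v a‖ ^ 2
        = (Fintype.card α - N - 2) * ‖∑ b ∈ F, v b‖ ^ 2 + ∑ a ∈ Fᶜ, ‖v a‖ ^ 2 := by
      simp only [norm_add_sq_real, sum_add_distrib, sum_const, nsmul_eq_mul, ← mul_sum, ← inner_sum,
        hcard, hcompl, inner_neg_right, real_inner_self_eq_norm_sq]
      ring
    obtain ⟨a, ha, hale⟩ : ∃ a ∈ Fᶜ, (Fintype.card α : ℝ) * ‖∑ b ∈ F, v b + v a‖ ^ 2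
        ≤ (N + 1 : ℝ) * ∑ a, ‖v a‖ ^ 2 := by
      apply exists_le_of_sum_le
      · rw [← card_pos, card_compl]
        omega
      · have h2 : (N : ℝ) + 2 ≤ Fintype.card α := by exact_mod_cast h1
        rw [← mul_sum, hsum, sum_const, nsmul_eq_mul, hcard]
        have := mul_le_mul_of_nonneg_left hle (sub_nonneg.2 h2)
        have := mul_le_mul_of_nonneg_left hsq (Nat.cast_nonneg (α := ℝ) (Fintype.card α))
        have := mul_nonneg (Nat.cast_nonneg (α := ℝ) N) hD
        nlinarith
    refine ⟨insert a F, ?_, ?_⟩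
    · rw [card_insert_of_notMem (by simpa using ha), hF]
    · rw [sum_insert (by simpa using ha), add_comm]
      exact_mod_cast hale

section

variable {C : Type*} {s : ℕ}

/-- The number of ordered pairs of distinct elements of `L` in a common class of `r`. -/
def collisions (L : Finset C) (r : C → Fin s) : ℕ :=
  #{p ∈ L.offDiag | r p.1 = r p.2}

theorem mul_sub_one_le_collisions (L : Finset C) (r : C → Fin s) (j : Fin s) :
    (#{c ∈ L | r c = j} : ℝ) * (#{c ∈ L | r c = j} - 1) ≤ collisions L r := by
  have h : #({c ∈ L | r c = j}.offDiag) ≤ collisions L r := by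
    apply card_le_card
    intro p
    simp only [mem_offDiag, mem_filter]
    rintro ⟨⟨h1, h2⟩, ⟨h3, h4⟩, h5⟩
    exact ⟨⟨h1, h3, h5⟩, h2.trans h4.symm⟩
  rw [offDiag_card] at h
  have h' : #{c ∈ L | r c = j} * #{c ∈ L | r c = j}
      ≤ collisions L r + #{c ∈ L | r c = j} := by omega
  have h'' : (#{c ∈ L | r c = j} : ℝ) * #{c ∈ L | r c = j}
      ≤ collisions L r + #{c ∈ L | r c = j} := by exact_mod_cast h'
  linarith

/-- The largest excess of a class of `r` in `L`. -/
noncomputable def maxExcess (L : Finset C) (r : C → Fin s) : ℝ :=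
  ⨆ j : Fin s, ((#{c ∈ L | r c = j} : ℝ) - 1)

theorem exists_maxExcess_eq [NeZero s] (L : Finset C) (r : C → Fin s) :
    ∃ n : ℕ, maxExcess L r = (n : ℝ) - 1 ∧ (n : ℝ) * (n - 1) ≤ collisions L r := by
  obtain ⟨j, hj⟩ :=
    exists_eq_ciSup_of_finite (f := fun j : Fin s => (#{c ∈ L | r c = j} : ℝ) - 1)
  exact ⟨_, hj.symm, mul_sub_one_le_collisions L r j⟩

theorem maxExcess_le_half_collisions [NeZero s] (L : Finset C) (r : C → Fin s) :
    maxExcess L r ≤ collisions L r / 2 := by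
  obtain ⟨n, hn, h⟩ := exists_maxExcess_eq L r
  rw [hn]
  have : (0 : ℝ) ≤ (n - 1) * (n - 2) := by
    rcases n with _ | _ | n
    · norm_num
    · norm_num
    · push_cast
      ring_nf
      positivity
  linarith

theorem maxExcess_tangent [NeZero s] (L : Finset C) (r : C → Fin s) (a : ℝ) :
    (2 * a + 1) * maxExcess L r ≤ collisions L r + a ^ 2 := by
  obtain ⟨n, hn, h⟩ := exists_maxExcess_eq L r
  rw [hn]
  nlinarith [sq_nonneg ((n : ℝ) - 1 - a)]

theorem sum_maxExcess_le [NeZero s] (F : Finset (C → Fin s)) (L : Finset C) {a : ℝ} (ha : 0 ≤ a)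
    (h : ∑ r ∈ F, (collisions L r : ℝ) ≤ #F * (a ^ 2 + a)) :
    ∑ r ∈ F, maxExcess L r ≤ #F * a := by
  have h1 := sum_le_sum fun r (_ : r ∈ F) => maxExcess_tangent L r a
  rw [← mul_sum, sum_add_distrib, sum_const, nsmul_eq_mul] at h1
  refine le_of_mul_le_mul_left (a := 2 * a + 1) ?_ (by positivity)
  linarith

theorem maxExcess_empty [NeZero s] (r : C → Fin s) : maxExcess ∅ r = -1 := by
  simp [maxExcess]

theorem one_le_sqrt_natCast [NeZero s] : 1 ≤ √(s : ℝ) :=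
  Real.one_le_sqrt.2 (by exact_mod_cast NeZero.one_le)

theorem sum_maxExcess_empty_le [NeZero s] (F : Finset (C → Fin s)) :
    ∑ r ∈ F, maxExcess ∅ r ≤ #F * (((#(∅ : Finset C) : ℝ) - 1) / √s) := by
  simp only [maxExcess_empty, sum_const, nsmul_eq_mul]
  gcongr
  rw [card_empty, Nat.cast_zero, zero_sub, neg_div, neg_le_neg_iff]
  exact div_le_one_of_le₀ one_le_sqrt_natCast (by positivity)

/-- Bound on the average largest excess when the average number of collisions in `L` is that of
uniform pairwise independent colors, up to a small error `e`. -/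
theorem sum_maxExcess_le_of_error [NeZero s] (F : Finset (C → Fin s)) (L : Finset C) {e : ℝ}
    (h : ∑ r ∈ F, (collisions L r : ℝ) ≤ #F * (#L * ((#L : ℝ) - 1) / s + e))
    (hL : L.Nonempty) (he : e * s ≤ ((#L : ℝ) - 1) * (√s - 1)) :
    ∑ r ∈ F, maxExcess L r ≤ #F * (((#L : ℝ) - 1) / √s) := by
  have h1 : (1 : ℝ) ≤ #L := by exact_mod_cast hL.card_pos
  have hs : 0 < √(s : ℝ) := one_pos.trans_le one_le_sqrt_natCast
  apply sum_maxExcess_le F L (div_nonneg (by linarith) hs.le)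
  refine h.trans (mul_le_mul_of_nonneg_left ?_ (by positivity))
  have hss : (s : ℝ) = √s ^ 2 := (Real.sq_sqrt (by positivity)).symm
  generalize √(s : ℝ) = q at *
  rw [hss] at he ⊢
  have : (((#L : ℝ) - 1) / q) ^ 2 + ((#L : ℝ) - 1) / q - #L * ((#L : ℝ) - 1) / q ^ 2
      = ((#L : ℝ) - 1) * (q - 1) / q ^ 2 := by
    field_simp
    ring
  have h2 : e ≤ ((#L : ℝ) - 1) * (q - 1) / q ^ 2 := by
    rw [le_div_iff₀ (by positivity)]
    exact he
  linarith

theorem sum_collisions (F : Finset (C → Fin s)) (L : Finset C) :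
    ∑ r ∈ F, (collisions L r : ℝ) = ∑ p ∈ L.offDiag, (#{r ∈ F | r p.1 = r p.2} : ℝ) := by
  simp only [collisions, card_filter, Nat.cast_sum]
  exact sum_comm

theorem cast_card_offDiag (L : Finset C) : (#L.offDiag : ℝ) = #L * ((#L : ℝ) - 1) := by
  rw [offDiag_card, Nat.cast_sub (Nat.le_mul_self _)]
  push_cast
  ring

theorem sum_maxExcess_le_of_card_eq [NeZero s] (F : Finset (C → Fin s))
    (hF : ∀ x y, x ≠ y → s * #{r ∈ F | r x = r y} = #F) (L : Finset C) :
    ∑ r ∈ F, maxExcess L r ≤ #F * (((#L : ℝ) - 1) / √s) := by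
  rcases L.eq_empty_or_nonempty with rfl | hL
  · exact sum_maxExcess_empty_le F
  have h1 : (1 : ℝ) ≤ #L := by exact_mod_cast hL.card_pos
  have hs0 : (s : ℝ) ≠ 0 := by exact_mod_cast NeZero.ne s
  refine sum_maxExcess_le_of_error F L (e := 0) (le_of_eq ?_) hL ?_
  · rw [sum_collisions, sum_congr rfl (g := fun _ => (#F : ℝ) / s), sum_const, nsmul_eq_mul,
      cast_card_offDiag]
    · ring
    · intro p hp
      rw [eq_div_iff hs0, mul_comm]
      exact_mod_cast hF p.1 p.2 (mem_offDiag.1 hp).2.2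
  · rw [zero_mul]
    exact mul_nonneg (by linarith) (sub_nonneg.2 one_le_sqrt_natCast)

end

theorem card_mul_card_filter_eq_zero {G W : Type*} [AddGroup G] [Fintype G] [AddGroup W]
    [DecidableEq W] (φ : G →+ W) (hφ : Function.Surjective φ) :
    Nat.card W * #{g | φ g = 0} = Fintype.card G := by
  rw [← Nat.card_eq_fintype_card, φ.ker.card_eq_card_quotient_mul_card_addSubgroup,
    Nat.card_congr (QuotientAddGroup.quotientKerEquivOfSurjective φ hφ).toEquiv]
  congr 1
  rw [Nat.card_eq_fintype_card]
  exact (Fintype.card_of_subtype _ (by simp)).symm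

/-- A group of functions whose differences at any two points take all values. -/
theorem card_mul_card_collide {C W : Type*} [AddCommGroup W] [DecidableEq W]
    (H : AddSubgroup (C → W)) [Fintype H] {x y : C}
    (h : ∀ w, ∃ f ∈ H, f x - f y = w) :
    Nat.card W * #{f : H | f.1 x = f.1 y} = Fintype.card H := by
  rw [← card_mul_card_filter_eq_zero
    (((Pi.evalAddMonoidHom (fun _ : C => W) x) - (Pi.evalAddMonoidHom (fun _ => W) y)).comp
      H.subtype)]
  · simp [sub_eq_zero]
  · intro w
    obtain ⟨f, hf, hw⟩ := h w
    exact ⟨⟨f, hf⟩, hw⟩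

theorem mul_card_collide_univ {C : Type*} [Fintype C] [DecidableEq C] {s : ℕ} [NeZero s] {x y : C}
    (hxy : x ≠ y) :
    s * #{f : C → Fin s | f x = f y} = Fintype.card (C → Fin s) := by
  have h := card_mul_card_filter_eq_zero
    ((Pi.evalAddMonoidHom (fun _ : C => Fin s) x) - (Pi.evalAddMonoidHom (fun _ => Fin s) y))
    fun w => ⟨Pi.single x w, by simp [hxy.symm]⟩
  simpa [sub_eq_zero] using h

/-- Linear maps `𝔽_p ^ k → 𝔽_p ^ m` collide at distinct points with probability `1 / p ^ m`. -/
theorem exists_linear_family {C : Type*} [Fintype C] [DecidableEq C] (p m k : ℕ) [Fact p.Prime]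
    (hk : Fintype.card C ≤ p ^ k) :
    ∃ F : Finset (C → Fin (p ^ m)), F.Nonempty ∧ #F ≤ (p ^ k) ^ m ∧
      ∀ x y, x ≠ y → p ^ m * #{r ∈ F | r x = r y} = #F := by
  classical
  obtain ⟨ι⟩ : Nonempty (C ↪ (Fin k → ZMod p)) :=
    Function.Embedding.nonempty_of_card_le (by simpa using hk)
  let Φ : (Fin m → Fin k → ZMod p) →+ (C → Fin m → ZMod p) :=
    { toFun := fun a c j => a j ⬝ᵥ ι c
      map_zero' := by ext; simp
      map_add' := fun a b => by ext; simp [add_dotProduct] }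
  obtain ⟨e⟩ : Nonempty ((Fin m → ZMod p) ≃ Fin (p ^ m)) :=
    ⟨Fintype.equivFinOfCardEq (by simp)⟩
  let g : Φ.range ↪ (C → Fin (p ^ m)) :=
    ⟨fun f => e ∘ f.1, fun f f' h => Subtype.ext (e.injective.comp_left h)⟩
  refine ⟨univ.map g, univ_nonempty.map, ?_, fun x y hxy => ?_⟩
  · rw [card_map, card_univ]
    refine (Fintype.card_le_of_surjective _ Φ.rangeRestrict_surjective).trans (le_of_eq ?_)
    simp
  · have h := card_mul_card_collide Φ.range (x := x) (y := y) fun w => by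
      obtain ⟨i, hi⟩ := Function.ne_iff.1 (ι.injective.ne hxy)
      refine ⟨_, ⟨fun j => Pi.single i (w j / (ι x i - ι y i)), rfl⟩, ?_⟩
      ext j
      simp only [Φ, AddMonoidHom.coe_mk, ZeroHom.coe_mk, Pi.sub_apply, single_dotProduct]
      rw [← mul_sub, div_mul_cancel₀ _ (sub_ne_zero.2 hi)]
    have hg (f : Φ.range) (z : C) : g f z = e (f.1 z) := rfl
    rw [filter_map, card_map, card_map, card_univ, ← h]
    simp only [Function.comp_def, hg, e.apply_eq_iff_eq]
    simp

/-- There is a family of distinct functions whose collision numbers have at most the variance they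
would have for `4 * |C| ^ 2` independent random functions. -/
theorem exists_family_sum_sq_le {C : Type*} [Fintype C] [Nonempty C] (s : ℕ) [NeZero s] :
    ∃ F : Finset (C → Fin s), F.Nonempty ∧ #F ≤ 4 * Fintype.card C ^ 2 ∧
      ∑ p ∈ (univ : Finset C).offDiag, ((#{r ∈ F | r p.1 = r p.2} : ℝ) - #F / s) ^ 2
        ≤ #F ^ 2 * ((s - 1) / (4 * s ^ 2)) := by
  classical
  let v : (C → Fin s) → EuclideanSpace ℝ (univ : Finset C).offDiag := fun f =>
    WithLp.toLp 2 fun p => (if f p.1.1 = f p.1.2 then 1 else 0) - 1 / (s : ℝ)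
  have hs : (0 : ℝ) < s := by exact_mod_cast NeZero.pos s
  have hs1 : (1 : ℝ) ≤ s := by exact_mod_cast NeZero.one_le
  have hn : (0 : ℝ) < Fintype.card C := by exact_mod_cast Fintype.card_pos
  set P := Fintype.card (C → Fin s) with hPdef
  have hP : 0 < P := Fintype.card_pos
  have hP' : (0 : ℝ) < P := by exact_mod_cast hP
  have hcount (p : (univ : Finset C).offDiag) :
      (#{f : C → Fin s | f p.1.1 = f p.1.2} : ℝ) = P / s := by
    rw [eq_div_iff hs.ne', mul_comm]
    exact_mod_cast mul_card_collide_univ (mem_offDiag.1 p.2).2.2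
  have hsum (F : Finset (C → Fin s)) (p : (univ : Finset C).offDiag) :
      (∑ f ∈ F, v f) p = (#{f ∈ F | f p.1.1 = f p.1.2} : ℝ) - #F / s := by
    simp [v, sum_sub_distrib, div_eq_mul_inv]
  have hv : ∑ f, v f = 0 := by
    ext p
    rw [hsum, hcount, card_univ]
    simp [P]
  have hnorm : ∑ f, ‖v f‖ ^ 2 ≤ Fintype.card C ^ 2 * (P * ((s - 1) / s ^ 2)) := by
    have hp (p : (univ : Finset C).offDiag) : ∑ f, (v f p) ^ 2 = P * ((s - 1) / s ^ 2) := by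
      have h (f) : (v f p) ^ 2
          = (1 - 2 / s) * (if f p.1.1 = f p.1.2 then 1 else 0) + 1 / (s : ℝ) ^ 2 := by
        simp only [v]
        split_ifs <;> field_simp <;> ring
      rw [sum_congr rfl fun f _ => h f, sum_add_distrib, ← mul_sum, sum_boole, hcount, sum_const,
        card_univ, nsmul_eq_mul]
      field_simp
      ring
    simp only [EuclideanSpace.real_norm_sq_eq]
    rw [sum_comm, sum_congr rfl fun p _ => hp p, sum_const, nsmul_eq_mul, card_univ,
      Fintype.card_coe]
    refine mul_le_mul_of_nonneg_right ?_
      (mul_nonneg hP'.le (div_nonneg (by linarith) (by positivity)))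
    rw [cast_card_offDiag, card_univ]
    nlinarith
  have hgoal (F : Finset (C → Fin s)) :
      ∑ p ∈ (univ : Finset C).offDiag, ((#{r ∈ F | r p.1 = r p.2} : ℝ) - #F / s) ^ 2
        = ‖∑ f ∈ F, v f‖ ^ 2 := by
    rw [EuclideanSpace.real_norm_sq_eq, ← sum_coe_sort]
    simp only [hsum]
  simp only [hgoal]
  rcases le_total P (4 * Fintype.card C ^ 2) with h | h
  · refine ⟨univ, univ_nonempty, h, ?_⟩
    rw [hv, norm_zero, zero_pow two_ne_zero]
    exact mul_nonneg (by positivity) (div_nonneg (by linarith) (by positivity))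
  · obtain ⟨F, hF, hle⟩ := exists_card_eq_norm_sum_sq_le v hv _ h
    refine ⟨F, ?_, hF.le, ?_⟩
    · rw [← card_pos, hF]
      positivity
    · rw [hF]
      have hle' := hle.trans (mul_le_mul_of_nonneg_left hnorm (by positivity))
      refine le_of_mul_le_mul_left (hle'.trans (le_of_eq ?_)) hP'
      push_cast
      field_simp
      ring

theorem exists_family_of_five_le {C : Type*} [Fintype C] [Nonempty C] (s : ℕ) [NeZero s]
    (hs : 5 ≤ s) :
    ∃ F : Finset (C → Fin s), F.Nonempty ∧ #F ≤ 4 * Fintype.card C ^ 2 ∧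
      ∀ L : Finset C, ∑ r ∈ F, maxExcess L r ≤ #F * (((#L : ℝ) - 1) / √s) := by
  obtain ⟨F, hF, hcard, hsq⟩ := exists_family_sum_sq_le (C := C) s
  refine ⟨F, hF, hcard, fun L => ?_⟩
  rcases L.eq_empty_or_nonempty with rfl | hL
  · exact sum_maxExcess_empty_le F
  have hs5 : (5 : ℝ) ≤ s := by exact_mod_cast hs
  have hss : √(s : ℝ) ^ 2 = s := Real.sq_sqrt (by positivity)
  have hq : 11 / 5 ≤ √(s : ℝ) := Real.le_sqrt_of_sq_le (by linarith)
  have hl : (1 : ℝ) ≤ #L := by exact_mod_cast hL.card_pos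
  have hrad : 0 ≤ (#L : ℝ) * (#L - 1) * (s - 1) :=
    mul_nonneg (mul_nonneg (by linarith) (by linarith)) (by linarith)
  set e : ℝ := √(#L * (#L - 1) * (s - 1)) / (2 * s) with he
  have hmain : ∑ r ∈ F, (collisions L r : ℝ) ≤ #F * (#L * ((#L : ℝ) - 1) / s + e) := by
    have hdev : ∑ p ∈ L.offDiag, ((#{r ∈ F | r p.1 = r p.2} : ℝ) - #F / s) ≤ #F * e := by
      refine le_of_abs_le (abs_le_of_sq_le_sq ?_ (by positivity))
      rw [mul_pow, he, div_pow, Real.sq_sqrt hrad]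
      calc _ ≤ (#L.offDiag : ℝ) * ∑ p ∈ L.offDiag, ((#{r ∈ F | r p.1 = r p.2} : ℝ) - #F / s) ^ 2 :=
            sq_sum_le_card_mul_sum_sq
        _ ≤ (#L.offDiag : ℝ) * (#F ^ 2 * ((s - 1) / (4 * s ^ 2))) := by
            refine mul_le_mul_of_nonneg_left (le_trans ?_ hsq) (by positivity)
            exact sum_le_sum_of_subset_of_nonneg (offDiag_mono (subset_univ L))
              fun _ _ _ => sq_nonneg _
        _ = _ := by
            rw [cast_card_offDiag]
            field_simp
            ring
    rw [sum_sub_distrib, sum_const, nsmul_eq_mul, cast_card_offDiag] at hdev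
    rw [sum_collisions]
    linarith [show (#F : ℝ) * (#L * (#L - 1) / s + e)
      = #L * (#L - 1) * (#F / s) + #F * e by ring]
  by_cases h2 : #L = 2
  · have h2' : (#L : ℝ) = 2 := by exact_mod_cast h2
    have hsqrt : √(#L * (#L - 1) * (s - 1)) ≤ 4 * (√s - 1) := by
      rw [Real.sqrt_le_iff]
      refine ⟨by linarith, ?_⟩
      rw [h2']
      generalize √(s : ℝ) = q at *
      rw [← hss]
      nlinarith
    calc ∑ r ∈ F, maxExcess L r ≤ ∑ r ∈ F, (collisions L r : ℝ) / 2 :=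
          sum_le_sum fun r _ => maxExcess_le_half_collisions L r
      _ ≤ #F * (#L * ((#L : ℝ) - 1) / s + e) / 2 := by
          rw [← sum_div]
          linarith
      _ ≤ #F * (1 / s + (√s - 1) / s) := by
          have : e ≤ 2 * ((√s - 1) / s) := by
            rw [he, div_le_iff₀ (by positivity)]
            refine hsqrt.trans (le_of_eq ?_)
            field_simp
            ring
          rw [mul_div_assoc]
          refine mul_le_mul_of_nonneg_left ?_ (by positivity)
          rw [h2', show (2 : ℝ) * (2 - 1) / s = 2 * (1 / s) by ring]
          linarith
      _ = #F * (((#L : ℝ) - 1) / √s) := by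
          rw [h2', ← add_div, add_sub_cancel, Real.sqrt_div_self']
          norm_num
  · refine sum_maxExcess_le_of_error F L hmain hL ?_
    have h13 : 0 ≤ ((#L : ℝ) - 1) * (#L - 3) := by
      rcases (show #L = 1 ∨ 3 ≤ #L by have := hL.card_pos; omega) with h | h
      · simp [h]
      · have : (3 : ℝ) ≤ #L := by exact_mod_cast h
        exact mul_nonneg (by linarith) (by linarith)
    have hsqrt : √(#L * (#L - 1) * (s - 1)) ≤ 2 * ((#L - 1) * (√s - 1)) := by
      rw [Real.sqrt_le_iff]
      refine ⟨mul_nonneg zero_le_two (mul_nonneg (by linarith) (by linarith)), ?_⟩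
      generalize √(s : ℝ) = q at *
      rw [← hss]
      have h8 : 0 ≤ 8 * (q - 1) ^ 2 - 3 * (q ^ 2 - 1) := by nlinarith
      have h9 : 0 ≤ q ^ 2 - 1 := by nlinarith
      nlinarith [mul_nonneg h13 h9, mul_nonneg (sq_nonneg ((#L : ℝ) - 1)) h8]
    calc e * s = √(#L * (#L - 1) * (s - 1)) / 2 := by
          rw [he]
          field_simp
      _ ≤ _ := by linarith

theorem exists_linear_family_sum_maxExcess_le {C : Type*} [Fintype C] (p m k : ℕ) [Fact p.Prime]
    (hk : Fintype.card C ≤ p ^ k) (hcard : (p ^ k) ^ m ≤ 4 * Fintype.card C ^ 2) :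
    ∃ F : Finset (C → Fin (p ^ m)), F.Nonempty ∧ #F ≤ 4 * Fintype.card C ^ 2 ∧
      ∀ L : Finset C, ∑ r ∈ F, maxExcess L r ≤ #F * (((#L : ℝ) - 1) / √(p ^ m : ℕ)) := by
  classical
  have : NeZero (p ^ m) := ⟨pow_ne_zero _ (Fact.out : p.Prime).ne_zero⟩
  obtain ⟨F, hF, hle, h⟩ := exists_linear_family (C := C) p m k hk
  exact ⟨F, hF, hle.trans hcard, sum_maxExcess_le_of_card_eq F h⟩

theorem exists_le_pow_le_mul {b n : ℕ} (hb : 1 < b) (hn : 0 < n) : ∃ k, n ≤ b ^ k ∧ b ^ k ≤ b * n := by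
  refine ⟨Nat.clog b n, Nat.le_pow_clog hb n, ?_⟩
  rcases hk : Nat.clog b n with _ | k
  · rw [pow_zero]
    exact Nat.mul_pos (by omega) hn
  · rw [pow_succ']
    exact Nat.mul_le_mul_left _ ((Nat.lt_clog_iff_pow_lt hb).1 (by omega)).le

theorem exists_family_sum_maxExcess_le {C : Type*} [Fintype C] [Nonempty C] (s : ℕ) [NeZero s] :
    ∃ F : Finset (C → Fin s), F.Nonempty ∧ #F ≤ 4 * Fintype.card C ^ 2 ∧
      ∀ L : Finset C, ∑ r ∈ F, maxExcess L r ≤ #F * (((#L : ℝ) - 1) / √s) := by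
  rcases le_or_gt 5 s with hs | hs
  · exact exists_family_of_five_le s hs
  have hs0 := NeZero.pos s
  have hn : 0 < Fintype.card C := Fintype.card_pos
  obtain ⟨k, hk, hk'⟩ := exists_le_pow_le_mul one_lt_two hn
  interval_cases s
  · exact exists_linear_family_sum_maxExcess_le 2 0 k hk (by nlinarith)
  · exact exists_linear_family_sum_maxExcess_le 2 1 k hk (by nlinarith)
  · obtain ⟨l, hl, hl'⟩ := exists_le_pow_le_mul (b := 3) (by norm_num) hn
    exact exists_linear_family_sum_maxExcess_le 3 1 l hl (by nlinarith)
  · exact exists_linear_family_sum_maxExcess_le 2 2 k hk (by nlinarith)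

/-- Lemma 3.9 of the paper: for integer `s ≥ 1` and a finite set `C` with `|C| ≥ 2`,
there is a family `F` of at most `4·|C|²` functions (partitions) `C → [s]` such that for every
collection `L₁, …, L_t` of subsets of `C`, the average over `r ∈ F` of
`∑ᵢ max_j (|Lᵢ ∩ r⁻¹(j)| − 1)` is at most `(1/√s)·∑ᵢ (|Lᵢ| − 1)`; in particular some `r ∈ F`
achieves this bound. -/
theorem partition_family_exists (s : ℕ) (hs : 1 ≤ s) {C : Type*} [Fintype C] [DecidableEq C]
    (hC : 2 ≤ Fintype.card C) :
    ∃ F : Finset (C → Fin s), F.Nonempty ∧ F.card ≤ 4 * Fintype.card C ^ 2 ∧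
      ∀ (t : ℕ) (L : Fin t → Finset C),
        (1 / (F.card : ℝ)) *
            ∑ r ∈ F, ∑ i, (⨆ j : Fin s, ((((L i).filter fun c => r c = j).card : ℝ) - 1))
          ≤ (1 / Real.sqrt s) * ∑ i, (((L i).card : ℝ) - 1) ∧
        ∃ r ∈ F, ∑ i, (⨆ j : Fin s, ((((L i).filter fun c => r c = j).card : ℝ) - 1))
          ≤ (1 / Real.sqrt s) * ∑ i, (((L i).card : ℝ) - 1) := by
  have : NeZero s := ⟨by omega⟩
  have : Nonempty C := Fintype.card_pos_iff.1 (by omega)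
  obtain ⟨F, hF, hcard, h⟩ := exists_family_sum_maxExcess_le (C := C) s
  refine ⟨F, hF, hcard, fun t L => ?_⟩
  have hF' : (0 : ℝ) < #F := by exact_mod_cast hF.card_pos
  have hsum : ∑ r ∈ F, ∑ i, maxExcess (L i) r ≤ #F * (1 / √s * ∑ i, ((#(L i) : ℝ) - 1)) := by
    rw [sum_comm, mul_sum, mul_sum]
    refine sum_le_sum fun i _ => (h (L i)).trans (le_of_eq ?_)
    ring
  constructor
  · rw [one_div_mul_eq_div, div_le_iff₀' hF']
    exact hsum
  · refine exists_le_of_sum_le hF (hsum.trans (le_of_eq ?_))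
    rw [sum_const, nsmul_eq_mul]
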